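/- arXiv:2410.05798 — 3 statements merged into one kernel-verified Lean document; each statement's English description precedes it below -/
import Mathlib

section
/- Let κ : ℝ → ℝ be strictly increasing with κ(0) = 0, and let h : ℝ → ℝ be differentiable. If h(0) ≥ 0 and for every t ≥ 0 the derivative satisfies h'(t) ≥ -κ(h(t)), then h(t) ≥ 0 for all t ≥ 0. -/
/-- CBF forward invariance with a general extended class-K function κ
(strictly increasing with κ(0) = 0): if h(0) ≥ 0 and h'(t) ≥ -κ(h(t)) for
all t ≥ 0, then h(t) ≥ 0 for all t ≥ 0. -/
theorem cbf_classK_forward_invariance (κ : ℝ → ℝ) (hκ : StrictMono κ)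
    (hκ0 : κ 0 = 0) (h : ℝ → ℝ) (hdiff : Differentiable ℝ h)
    (h0 : h 0 ≥ 0) (hineq : ∀ t ≥ (0 : ℝ), deriv h t ≥ -κ (h t)) :
    ∀ t ≥ (0 : ℝ), h t ≥ 0 := by
  intro t ht
  suffices -h t ≤ 0 by linarith
  refine le_of_forall_pos_le_add fun ε hε => ?_
  rw [zero_add]
  refine image_le_of_deriv_right_lt_deriv_boundary (f := fun x => -h x)
    (f' := fun x => -deriv h x) (a := 0) (b := t) (B := fun _ => ε) (B' := fun _ => 0)
    hdiff.continuous.neg.continuousOn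
    (fun x _ => (hdiff x).hasDerivAt.neg.hasDerivWithinAt) (by linarith)
    (fun x => hasDerivAt_const x ε) (fun x hx hxε => ?_) ⟨ht, le_rfl⟩
  have hκ_neg : κ (h x) < 0 := hκ0 ▸ hκ (show h x < 0 by linarith)
  linarith [hineq x hx.1]
end

section
/- Let E = EuclideanSpace ℝ (Fin n), let h : E → ℝ be continuously differentiable, let γ ∈ ℝ, and let x : ℝ → E be a differentiable curve. If h(x(0)) ≥ 0 and for every t ≥ 0 one has (Dh)(x(t))(x'(t)) + γ · h(x(t)) ≥ 0, where (Dh)(x(t)) denotes the Fréchet derivative of h at x(t) and x'(t) the time derivative of the curve, then h(x(t)) ≥ 0 for all t ≥ 0. -/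
/-- Grönwall-type comparison: a function with `f' + γ f ≥ 0` on `[0, ∞)` that starts nonnegative
stays nonnegative. -/
theorem nonneg_of_deriv_add_mul_nonneg {f f' : ℝ → ℝ} {γ : ℝ}
    (hf : ∀ t, 0 ≤ t → HasDerivAt f (f' t) t) (h0 : 0 ≤ f 0)
    (hineq : ∀ t, 0 ≤ t → 0 ≤ f' t + γ * f t) {t : ℝ} (ht : 0 ≤ t) : 0 ≤ f t := by
  have hderiv : ∀ s, 0 ≤ s → HasDerivAt (fun s => Real.exp (γ * s) * f s)
      (Real.exp (γ * s) * (f' s + γ * f s)) s := fun s hs => by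
    refine ((((hasDerivAt_id s).const_mul γ).exp).mul (hf s hs)).congr_deriv ?_
    simp only [id]
    ring
  have hmono : MonotoneOn (fun s => Real.exp (γ * s) * f s) (Set.Ici 0) := by
    refine monotoneOn_of_deriv_nonneg (convex_Ici 0)
      (fun s hs => (hderiv s hs).continuousAt.continuousWithinAt)
      (fun s hs => (hderiv s (interior_subset hs)).differentiableAt.differentiableWithinAt)
      fun s hs => ?_
    have hs' : 0 ≤ s := interior_subset hs
    rw [(hderiv s hs').deriv]
    exact mul_nonneg (Real.exp_pos _).le (hineq s hs')
  have key := hmono Set.self_mem_Ici ht ht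
  simp only [mul_zero, Real.exp_zero, one_mul] at key
  exact nonneg_of_mul_nonneg_right (h0.trans key) (Real.exp_pos _)

/-- Lemma 1 of the paper along a trajectory: if h is C¹, the curve x is
differentiable, h(x(0)) ≥ 0 and Dh(x(t))(x'(t)) + γ·h(x(t)) ≥ 0 for all
t ≥ 0, then h(x(t)) ≥ 0 for all t ≥ 0. -/
theorem cbf_trajectory_forward_invariance (n : ℕ)
    (h : EuclideanSpace ℝ (Fin n) → ℝ) (γ : ℝ) (hh : ContDiff ℝ 1 h)
    (x : ℝ → EuclideanSpace ℝ (Fin n)) (hx : Differentiable ℝ x)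
    (h0 : h (x 0) ≥ 0)
    (hineq : ∀ t ≥ (0 : ℝ), fderiv ℝ h (x t) (deriv x t) + γ * h (x t) ≥ 0) :
    ∀ t ≥ (0 : ℝ), h (x t) ≥ 0 := by
  intro t ht
  exact nonneg_of_deriv_add_mul_nonneg (f := h ∘ x)
    (fun s _ => (hh.differentiable one_ne_zero (x s)).hasFDerivAt.comp_hasDerivAt s
      (hx s).hasDerivAt) h0 hineq ht
end

section
/- Let E = EuclideanSpace ℝ (Fin n), let h : E → ℝ be continuously differentiable, let κ : ℝ → ℝ be strictly increasing with κ(0) = 0, and let x : ℝ → E be a differentiable curve. If h(x(0)) ≥ 0 and for every t ≥ 0 one has (Dh)(x(t))(x'(t)) + κ(h(x(t))) ≥ 0, then h(x(t)) ≥ 0 for all t ≥ 0. -/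
/-- Lemma 2 of the paper along a trajectory with a general extended
class-K function κ: if h is C¹, x differentiable, h(x(0)) ≥ 0 and
Dh(x(t))(x'(t)) + κ(h(x(t))) ≥ 0 for all t ≥ 0, then h(x(t)) ≥ 0 for
all t ≥ 0. -/
theorem gcbf_trajectory_forward_invariance (n : ℕ)
    (h : EuclideanSpace ℝ (Fin n) → ℝ) (hh : ContDiff ℝ 1 h)
    (κ : ℝ → ℝ) (hκ : StrictMono κ) (hκ0 : κ 0 = 0)
    (x : ℝ → EuclideanSpace ℝ (Fin n)) (hx : Differentiable ℝ x)
    (h0 : h (x 0) ≥ 0)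
    (hineq : ∀ t ≥ (0 : ℝ), fderiv ℝ h (x t) (deriv x t) + κ (h (x t)) ≥ 0) :
    ∀ t ≥ (0 : ℝ), h (x t) ≥ 0 := by
  intro T hT
  have hd : ∀ t, HasDerivAt (fun t => h (x t)) (fderiv ℝ h (x t) (deriv x t)) t := fun t =>
    (hh.differentiable one_ne_zero (x t)).hasFDerivAt.comp_hasDerivAt t (hx t).hasDerivAt
  -- Compare `-h ∘ x` with each positive constant barrier `ε`.
  have key : ∀ ε > (0 : ℝ), -h (x T) ≤ 0 + ε := by
    intro ε hε
    rw [zero_add]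
    refine image_le_of_deriv_right_lt_deriv_boundary (f := fun t => -h (x t))
      (f' := fun t => -fderiv ℝ h (x t) (deriv x t)) (B := fun _ => ε) (B' := fun _ => 0)
      (fun t _ => (hd t).neg.continuousAt.continuousWithinAt)
      (fun t _ => (hd t).neg.hasDerivWithinAt) (by linarith)
      (fun t => hasDerivAt_const t ε) ?_ (Set.right_mem_Icc.2 hT)
    intro t ht hte
    have hneg : h (x t) < 0 := by linarith
    have hκneg := hκ hneg
    have := hineq t ht.1
    linarith
  linarith [le_of_forall_pos_le_add key]
end
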